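/- Let n ≥ 1, 0 < s < 1 and C₀ > 0. There exists a constant C = C(n,s) > 0 such that for every nonnegative u ∈ C^{1,1}_{loc}(B_1(0)) ∩ L_{2s} satisfying (-Δ)^s u(x) ≥ −C₀ classically for all x ∈ B_1(0), one has ∫_{ℝⁿ} u(y)/(1+|y|)^{n+2s} dy ≤ C (inf_{B_{1/2}(0)} u + C₀). -/

import Mathlib

open MeasureTheory Metric Set Filter
open scoped Topology NNReal ENNReal RealInnerProductSpace

noncomputable section

/-- `n`-dimensional Euclidean space `ℝⁿ`. -/
abbrev Euc (n : ℕ) := EuclideanSpace ℝ (Fin n)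

/-- The standard normalization constant `C_{n,s}` of the fractional Laplacian,
`C_{n,s} = 4^s Γ(n/2+s) / (π^{n/2} |Γ(-s)|) = s·4^s·Γ(n/2+s) / (π^{n/2} Γ(1-s))`. -/
def fracC (n : ℕ) (s : ℝ) : ℝ :=
  s * 4 ^ s * Real.Gamma ((n : ℝ) / 2 + s) /
    (Real.pi ^ ((n : ℝ) / 2) * Real.Gamma (1 - s))

/-- `(-Δ)^s u (x) = v` in the classical (Cauchy principal value) sense: the truncated
integrals `C_{n,s} ∫_{|x-y| ≥ ε} (u(x) - u(y))/|x-y|^{n+2s} dy` tend to `v` as `ε → 0⁺`. -/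
def HasFracLapAt (n : ℕ) (s : ℝ) (u : Euc n → ℝ) (x : Euc n) (v : ℝ) : Prop :=
  Tendsto (fun ε : ℝ =>
      fracC n s *
        ∫ y in {y : Euc n | ε ≤ dist x y}, (u x - u y) / dist x y ^ ((n : ℝ) + 2 * s))
    (𝓝[>] (0 : ℝ)) (𝓝 v)

/-- The tail space `L_{2s}`: locally integrable functions with
`∫_{ℝⁿ} |u(y)|/(1+|y|^{n+2s}) dy < ∞`. -/
def MemL2s (n : ℕ) (s : ℝ) (u : Euc n → ℝ) : Prop :=
  LocallyIntegrable u volume ∧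
    Integrable (fun y : Euc n => |u y| / (1 + ‖y‖ ^ ((n : ℝ) + 2 * s))) volume

/-- The `L_{2s}` norm `‖u‖_{L_{2s}} = ∫_{ℝⁿ} |u(y)|/(1+|y|^{n+2s}) dy`. -/
def l2sNorm (n : ℕ) (s : ℝ) (u : Euc n → ℝ) : ℝ :=
  ∫ y : Euc n, |u y| / (1 + ‖y‖ ^ ((n : ℝ) + 2 * s))

/-- `u ∈ C^{1,1}_{loc}(Ω)`: near every point of `Ω`, `u` is `C^1` with a Lipschitz
continuous derivative. -/
def C11LocOn (n : ℕ) (u : Euc n → ℝ) (Ω : Set (Euc n)) : Prop :=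
  ∀ x ∈ Ω, ∃ ε > 0, ball x ε ⊆ Ω ∧ ContDiffOn ℝ 1 u (ball x ε) ∧
    ∃ L : ℝ≥0, LipschitzOnWith L (fun y => fderiv ℝ u y) (ball x ε)

/-- The `C^γ(K)` norm (`0 < γ < 1`) of `u` is bounded by `A`: both the sup norm and the
`γ`-Hölder seminorm of `u` on `K` are at most `A`. -/
def HolderBoundOn (n : ℕ) (γ : ℝ) (u : Euc n → ℝ) (K : Set (Euc n)) (A : ℝ) : Prop :=
  (∀ x ∈ K, |u x| ≤ A) ∧ ∀ x ∈ K, ∀ y ∈ K, |u x - u y| ≤ A * dist x y ^ γ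

/-- Two-sided (interior and exterior) tangent ball condition of radius `ρ` at a boundary
point `z` of `Ω`.  A uniform two-sided ball condition is the standard geometric
characterization of a (locally) `C^{1,1}` boundary: the radius `ρ` is controlled by the
local `C^{1,1}` norm of `∂Ω` and vice versa. -/
def TwoSidedBallAt (n : ℕ) (Ω : Set (Euc n)) (ρ : ℝ) (z : Euc n) : Prop :=
  ∃ ν : Euc n, ‖ν‖ = 1 ∧ ball (z + ρ • ν) ρ ⊆ Ω ∧ ball (z - ρ • ν) ρ ⊆ Ωᶜ

/-- The truncated paraboloid `max 0 (2 - 4‖x‖²)`: a semiconvex cutoff which is at least `1` on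
`B_{1/2}` and vanishes outside `B_{3/4}`. -/
def paraboloidCutoff {n : ℕ} (x : Euc n) : ℝ := max 0 (2 - 4 * ‖x‖ ^ 2)

/-- An integrable majorant of `min (4‖z‖²) 2 / ‖z‖^N` for `n < N < n + 2`. -/
def kernelMajorant (n : ℕ) (N : ℝ) (z : Euc n) : ℝ :=
  4 * (ball (0 : Euc n) 1).indicator (fun z => ‖z‖ ^ (2 - N)) z
    + 2 * 2 ^ N * (1 + ‖z‖) ^ (-N)

/-- The first-order term `⟪p, z⟫ / ‖z‖^N`, truncated to the annulus `ε ≤ ‖z‖ < 1`. -/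
def truncatedLinear (n : ℕ) (N ε : ℝ) (p z : Euc n) : ℝ :=
  {z : Euc n | ε ≤ ‖z‖ ∧ ‖z‖ < 1}.indicator (fun z => ⟪p, z⟫ / ‖z‖ ^ N) z

lemma continuous_paraboloidCutoff {n : ℕ} : Continuous (paraboloidCutoff (n := n)) := by
  unfold paraboloidCutoff; fun_prop

lemma paraboloidCutoff_nonneg {n : ℕ} (x : Euc n) : 0 ≤ paraboloidCutoff x := le_max_left _ _

lemma paraboloidCutoff_le_two {n : ℕ} (x : Euc n) : paraboloidCutoff x ≤ 2 :=
  max_le (by norm_num) (by nlinarith [sq_nonneg ‖x‖])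

lemma one_le_paraboloidCutoff {n : ℕ} {x : Euc n} (hx : ‖x‖ ≤ 1 / 2) :
    1 ≤ paraboloidCutoff x :=
  le_max_of_le_right (by nlinarith [norm_nonneg x])

lemma paraboloidCutoff_eq_zero {n : ℕ} {x : Euc n} (hx : 3 / 4 ≤ ‖x‖) :
    paraboloidCutoff x = 0 :=
  max_eq_left (by nlinarith)

lemma exists_semiconvex_paraboloidCutoff {n : ℕ} (x : Euc n) :
    ∃ p : Euc n, ∀ y, paraboloidCutoff x - paraboloidCutoff y ≤ ⟪p, y - x⟫ + 4 * ‖y - x‖ ^ 2 := by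
  rcases le_total (2 - 4 * ‖x‖ ^ 2) 0 with h | h
  · refine ⟨0, fun y => ?_⟩
    have hx : paraboloidCutoff x = 0 := max_eq_left h
    have := paraboloidCutoff_nonneg y
    rw [hx, inner_zero_left]
    nlinarith [sq_nonneg ‖y - x‖]
  · refine ⟨(8 : ℝ) • x, fun y => ?_⟩
    have hx : paraboloidCutoff x = 2 - 4 * ‖x‖ ^ 2 := max_eq_right h
    have hy : 2 - 4 * ‖y‖ ^ 2 ≤ paraboloidCutoff y := le_max_right _ _
    have h1 : ‖y‖ ^ 2 = ‖x‖ ^ 2 + 2 * ⟪x, y - x⟫ + ‖y - x‖ ^ 2 := by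
      rw [← norm_add_sq_real, add_sub_cancel]
    rw [real_inner_smul_left]
    linarith

lemma kernelMajorant_nonneg {n : ℕ} {N : ℝ} (z : Euc n) : 0 ≤ kernelMajorant n N z := by
  have : 0 ≤ (ball (0 : Euc n) 1).indicator (fun z => ‖z‖ ^ (2 - N)) z :=
    indicator_nonneg (fun z _ => by positivity) z
  unfold kernelMajorant
  positivity

lemma integrable_kernelMajorant {n : ℕ} (hn : 1 ≤ n) {N : ℝ} (h1 : n < N) (h2 : N < n + 2) :
    Integrable (kernelMajorant n N) := by
  have : Nonempty (Fin n) := ⟨⟨0, hn⟩⟩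
  unfold kernelMajorant
  refine Integrable.add (Integrable.const_mul ?_ _) (Integrable.const_mul ?_ _)
  · rw [integrable_indicator_iff measurableSet_ball]
    rw [integrableOn_fun_norm_addHaar volume (f := fun t : ℝ => t ^ (2 - N))]
    have h : IntegrableOn (fun y : ℝ => y ^ ((n : ℝ) + 1 - N)) (Ioo 0 1) := by
      rw [← intervalIntegrable_iff_integrableOn_Ioo_of_le zero_le_one]
      exact intervalIntegral.intervalIntegrable_rpow' (by linarith)
    refine h.congr_fun (fun y hy => ?_) measurableSet_Ioo
    have hfin : Module.finrank ℝ (Euc n) - 1 = n - 1 := by simp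
    simp only [hfin, smul_eq_mul]
    rw [← Real.rpow_natCast, ← Real.rpow_add hy.1, Nat.cast_sub hn]
    congr 1
    push_cast
    ring
  · exact integrable_one_add_norm (by simpa using h1)

lemma le_truncatedLinear_add_kernelMajorant {n : ℕ} {N ε : ℝ} (hN : 0 ≤ N) {p z : Euc n} {t : ℝ}
    (hε : 0 < ε) (hz : ε ≤ ‖z‖) (h4 : t ≤ ⟪p, z⟫ + 4 * ‖z‖ ^ 2) (h2 : t ≤ 2) :
    t / ‖z‖ ^ N ≤ truncatedLinear n N ε p z + kernelMajorant n N z := by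
  have hz0 : 0 < ‖z‖ := hε.trans_le hz
  have hpow : 0 < ‖z‖ ^ N := by positivity
  unfold truncatedLinear kernelMajorant
  by_cases h : ‖z‖ < 1
  · rw [indicator_of_mem (show z ∈ {z : Euc n | ε ≤ ‖z‖ ∧ ‖z‖ < 1} from ⟨hz, h⟩),
      indicator_of_mem (by simpa using h), Real.rpow_sub hz0, Real.rpow_two]
    have : 0 ≤ 2 * 2 ^ N * (1 + ‖z‖) ^ (-N) := by positivity
    have h5 : t / ‖z‖ ^ N ≤ (⟪p, z⟫ + 4 * ‖z‖ ^ 2) / ‖z‖ ^ N := by gcongr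
    rw [add_div, mul_div_assoc] at h5
    linarith
  · rw [indicator_of_notMem (by simp [h]), indicator_of_notMem (by simpa using h)]
    have h6 : (1 + ‖z‖) ^ N ≤ 2 ^ N * ‖z‖ ^ N := by
      rw [← Real.mul_rpow (by norm_num) hz0.le]
      exact Real.rpow_le_rpow (by positivity) (by linarith) hN
    have h7 : t / ‖z‖ ^ N ≤ 2 / ‖z‖ ^ N := by gcongr
    have h8 : 2 / ‖z‖ ^ N ≤ 2 * 2 ^ N * (1 + ‖z‖) ^ (-N) := by
      rw [Real.rpow_neg (by positivity), ← div_eq_mul_inv, div_le_div_iff₀ hpow (by positivity)]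
      linarith
    linarith

lemma integral_truncatedLinear (n : ℕ) (N ε : ℝ) (p : Euc n) :
    ∫ z, truncatedLinear n N ε p z = 0 := by
  have h : ∫ z, truncatedLinear n N ε p (-z) = ∫ z, truncatedLinear n N ε p z :=
    integral_neg_eq_self _ _
  have hodd : ∀ z, truncatedLinear n N ε p (-z) = -truncatedLinear n N ε p z := by
    intro z
    unfold truncatedLinear
    by_cases hz : ε ≤ ‖z‖ ∧ ‖z‖ < 1 <;>
      simp [indicator, hz, neg_div]
  simp only [hodd, integral_neg] at h
  linarith

lemma integrable_truncatedLinear {n : ℕ} {N ε : ℝ} (hN : 0 ≤ N) (hε : 0 < ε) (p : Euc n) :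
    Integrable (truncatedLinear n N ε p) := by
  unfold truncatedLinear
  have hm : MeasurableSet {z : Euc n | ε ≤ ‖z‖ ∧ ‖z‖ < 1} :=
    (measurableSet_le measurable_const measurable_norm).inter
      (measurableSet_lt measurable_norm measurable_const)
  rw [integrable_indicator_iff hm]
  refine IntegrableOn.of_bound (C := ‖p‖ / ε ^ N) ?_ ?_ ?_
  · exact (measure_mono (fun z hz => by simpa using hz.2)).trans_lt
      (measure_ball_lt_top (x := (0 : Euc n)) (r := 1))
  · exact Measurable.aestronglyMeasurable (by fun_prop)
  · refine (ae_restrict_iff' hm).2 (ae_of_all _ fun z hz => ?_)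
    have hz0 : 0 < ‖z‖ := hε.trans_le hz.1
    have h1 : |⟪p, z⟫| ≤ ‖p‖ := (abs_real_inner_le_norm p z).trans
      (mul_le_of_le_one_right (norm_nonneg p) hz.2.le)
    have h2 : ε ^ N ≤ ‖z‖ ^ N := Real.rpow_le_rpow hε.le hz.1 hN
    have h3 : 0 < ε ^ N := by positivity
    rw [Real.norm_eq_abs, abs_div, abs_of_pos (show 0 < ‖z‖ ^ N by positivity)]
    gcongr

lemma fracC_pos (n : ℕ) {s : ℝ} (hs0 : 0 < s) (hs1 : s < 1) : 0 < fracC n s := by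
  have h1 : 0 < Real.Gamma ((n : ℝ) / 2 + s) := Real.Gamma_pos_of_pos (by positivity)
  have h2 : 0 < Real.Gamma (1 - s) := Real.Gamma_pos_of_pos (by linarith)
  have := Real.pi_pos
  unfold fracC
  positivity

lemma C11LocOn.continuousOn {n : ℕ} {u : Euc n → ℝ} {Ω : Set (Euc n)} (h : C11LocOn n u Ω) :
    ContinuousOn u Ω := by
  intro x hx
  obtain ⟨ε, hε, -, hc, -⟩ := h x hx
  exact (hc.continuousOn.continuousAt (ball_mem_nhds x hε)).continuousWithinAt

lemma one_add_rpow_le {N t : ℝ} (hN : 0 ≤ N) (ht : 0 ≤ t) : 1 + t ^ N ≤ 2 * (1 + t) ^ N := by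
  have h1 : 1 ≤ (1 + t) ^ N := Real.one_le_rpow (by linarith) hN
  have h2 : t ^ N ≤ (1 + t) ^ N := Real.rpow_le_rpow ht (by linarith) hN
  linarith

lemma MemL2s.integrable_div {n : ℕ} {s : ℝ} (hs0 : 0 < s) {u : Euc n → ℝ} (hu : MemL2s n s u) :
    Integrable (fun y => u y / (1 + ‖y‖) ^ ((n : ℝ) + 2 * s)) := by
  refine (hu.2.const_mul 2).mono'
    (hu.1.aestronglyMeasurable.aemeasurable.div
      (Measurable.aemeasurable (by fun_prop))).aestronglyMeasurable
    (ae_of_all _ fun y => ?_)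
  have h0 : 0 < 1 + ‖y‖ ^ ((n : ℝ) + 2 * s) := by positivity
  have h1 := one_add_rpow_le (N := n + 2 * s) (by positivity) (norm_nonneg y)
  rw [Real.norm_eq_abs, abs_div,
    abs_of_pos (show 0 < (1 + ‖y‖) ^ ((n : ℝ) + 2 * s) by positivity), ← mul_div_assoc,
    div_le_div_iff₀ (by positivity) h0]
  nlinarith [mul_le_mul_of_nonneg_left h1 (abs_nonneg (u y))]

lemma measurableSet_le_dist {n : ℕ} (x : Euc n) (ε : ℝ) :
    MeasurableSet {y : Euc n | ε ≤ dist x y} :=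
  measurableSet_le measurable_const (by fun_prop)

lemma MemL2s.integrableOn_sub_div {n : ℕ} {s : ℝ} (hs0 : 0 < s) {u : Euc n → ℝ}
    (hu : MemL2s n s u) {x : Euc n} (hx : ‖x‖ ≤ 1) {ε : ℝ} (hε : 0 < ε) :
    IntegrableOn (fun y => (u x - u y) / dist x y ^ ((n : ℝ) + 2 * s))
      {y : Euc n | ε ≤ dist x y} := by
  set N : ℝ := n + 2 * s with hN
  have hN0 : 0 ≤ N := by positivity
  have h1 : Integrable (fun y : Euc n => u x * (1 + ‖y‖) ^ (-N)) :=
    (integrable_one_add_norm (by simp [hN, hs0])).const_mul _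
  have h2 := ((h1.sub (hu.integrable_div hs0)).norm.const_mul ((2 / ε + 1) ^ N)).integrableOn
    (s := {y : Euc n | ε ≤ dist x y})
  refine Integrable.mono' h2 ?_ ((ae_restrict_iff' (measurableSet_le_dist x ε)).2
    (ae_of_all _ fun y hy => ?_))
  · exact ((aemeasurable_const.sub hu.1.aestronglyMeasurable.aemeasurable).div
      (Measurable.aemeasurable (by fun_prop))).aestronglyMeasurable.restrict
  · have hd : 0 < dist x y := hε.trans_le hy
    have hle : 1 + ‖y‖ ≤ (2 / ε + 1) * dist x y := by
      have h3 : ‖y‖ ≤ ‖x‖ + dist x y := by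
        rw [dist_comm, dist_eq_norm]
        simpa using norm_add_le x (y - x)
      have h4 : 2 ≤ 2 / ε * dist x y := by
        rw [div_mul_eq_mul_div, le_div_iff₀ hε]
        have : ε ≤ dist x y := hy
        linarith
      linarith
    have hpow : (1 + ‖y‖) ^ N ≤ (2 / ε + 1) ^ N * dist x y ^ N := by
      rw [← Real.mul_rpow (by positivity) hd.le]
      exact Real.rpow_le_rpow (by positivity) hle hN0
    have hy0 : 0 < (1 + ‖y‖) ^ N := by positivity
    have hd0 : 0 < dist x y ^ N := by positivity
    simp only [Pi.sub_apply]
    rw [Real.rpow_neg (by positivity), ← div_eq_mul_inv, ← sub_div, norm_div, norm_div,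
      Real.norm_of_nonneg hy0.le, Real.norm_of_nonneg hd0.le, ← mul_div_assoc,
      div_le_div_iff₀ hd0 hy0]
    nlinarith [mul_le_mul_of_nonneg_left hpow (norm_nonneg (u x - u y))]

/-- A nonnegative continuous function is touched from below, up to an additive constant, by a
multiple of the cutoff. -/
lemma exists_touching_point {n : ℕ} {u : Euc n → ℝ} (hu : ∀ x, 0 ≤ u x)
    (hc : ContinuousOn u (ball 0 1)) {x₀ : Euc n} (hx₀ : ‖x₀‖ ≤ 1 / 2) :
    ∃ x : Euc n, ‖x‖ < 1 ∧ u x - u x₀ * paraboloidCutoff x ≤ 0 ∧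
      ∀ y, u x - u x₀ * paraboloidCutoff x ≤ u y - u x₀ * paraboloidCutoff y := by
  have hsub : closedBall (0 : Euc n) (3 / 4) ⊆ ball 0 1 := closedBall_subset_ball (by norm_num)
  have hmem : x₀ ∈ closedBall (0 : Euc n) (3 / 4) := by
    rw [mem_closedBall_zero_iff]; linarith
  obtain ⟨x, hx, hmin⟩ := (isCompact_closedBall (0 : Euc n) (3 / 4)).exists_isMinOn
    (f := fun y => u y - u x₀ * paraboloidCutoff y) ⟨x₀, hmem⟩
    ((hc.mono hsub).sub (continuous_const.mul continuous_paraboloidCutoff).continuousOn)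
  have hle : u x - u x₀ * paraboloidCutoff x ≤ 0 := by
    refine (hmin hmem).trans ?_
    nlinarith [hu x₀, one_le_paraboloidCutoff hx₀]
  refine ⟨x, by simpa using hsub hx, hle, fun y => ?_⟩
  by_cases hy : y ∈ closedBall (0 : Euc n) (3 / 4)
  · exact hmin hy
  · rw [paraboloidCutoff_eq_zero (x := y) (by simpa using (not_le.1 (by simpa using hy)).le)]
    simpa using hle.trans (hu y)

/-- If `u ≥ 0` is touched from below at `x` by `A` times the cutoff, then truncated weighted
integrals of `u` are controlled by the truncated integrals defining `(-Δ)^s u x`. -/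
lemma setIntegral_div_le {n : ℕ} (hn : 1 ≤ n) {s : ℝ} (hs0 : 0 < s) (hs1 : s < 1)
    {u : Euc n → ℝ} (hL : MemL2s n s u) {A : ℝ} (hA : 0 ≤ A) {x : Euc n} (hx : ‖x‖ < 1)
    (h0 : u x - A * paraboloidCutoff x ≤ 0)
    (hmin : ∀ y, u x - A * paraboloidCutoff x ≤ u y - A * paraboloidCutoff y)
    {ε : ℝ} (hε : 0 < ε) :
    ∫ y in {y : Euc n | ε ≤ dist x y}, u y / (1 + ‖y‖) ^ ((n : ℝ) + 2 * s) ≤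
      A * ((∫ z, kernelMajorant n (n + 2 * s) z) + 2 * volume.real (ball (0 : Euc n) 1)) -
      ∫ y in {y : Euc n | ε ≤ dist x y}, (u x - u y) / dist x y ^ ((n : ℝ) + 2 * s) := by
  set N : ℝ := n + 2 * s with hN
  have hN0 : 0 ≤ N := by positivity
  set S : Set (Euc n) := {y : Euc n | ε ≤ dist x y} with hS
  have hSm : MeasurableSet S := measurableSet_le_dist x ε
  obtain ⟨p, hp⟩ := exists_semiconvex_paraboloidCutoff x
  have hF := hL.integrableOn_sub_div hs0 hx.le hε
  have hG : Integrable (fun y => kernelMajorant n N (y - x)) :=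
    (integrable_kernelMajorant hn (by simp [hN, hs0]) (by rw [hN]; linarith)).comp_sub_right x
  have hT : Integrable (fun y => truncatedLinear n N ε p (y - x)) :=
    (integrable_truncatedLinear hN0 hε p).comp_sub_right x
  have hB : Integrable ((ball (0 : Euc n) 1).indicator (fun _ => (2 : ℝ))) :=
    (integrable_indicator_iff measurableSet_ball).2 (integrableOn_const measure_ball_lt_top.ne)
  have hpt : ∀ y ∈ S, u y / (1 + ‖y‖) ^ N ≤
      A * (truncatedLinear n N ε p (y - x) + kernelMajorant n N (y - x)
        + (ball (0 : Euc n) 1).indicator (fun _ => (2 : ℝ)) y)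
        - (u x - u y) / dist x y ^ N := by
    intro y hy
    have hy : ε ≤ dist x y := hy
    have hdn : dist x y = ‖y - x‖ := by rw [dist_comm, dist_eq_norm]
    have hd : 0 < dist x y := hε.trans_le hy
    have hd0 : 0 < dist x y ^ N := by positivity
    have hdle : dist x y ^ N ≤ (1 + ‖y‖) ^ N := by
      refine Real.rpow_le_rpow hd.le ?_ hN0
      rw [dist_eq_norm]
      linarith [norm_sub_le x y]
    have hker := le_truncatedLinear_add_kernelMajorant (N := N) hN0 hε (by rwa [← hdn]) (hp y)
      (by linarith [paraboloidCutoff_le_two x, paraboloidCutoff_nonneg y])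
    rw [← hdn] at hker
    have hcut : paraboloidCutoff y / (1 + ‖y‖) ^ N ≤
        (ball (0 : Euc n) 1).indicator (fun _ => (2 : ℝ)) y := by
      by_cases hy1 : y ∈ ball (0 : Euc n) 1
      · rw [indicator_of_mem hy1]
        exact (div_le_self (paraboloidCutoff_nonneg y)
          (Real.one_le_rpow (by linarith [norm_nonneg y]) hN0)).trans (paraboloidCutoff_le_two y)
      · rw [indicator_of_notMem hy1, paraboloidCutoff_eq_zero, zero_div]
        have : 1 ≤ ‖y‖ := by simpa using hy1
        linarith
    set w : ℝ := u y - A * paraboloidCutoff y - (u x - A * paraboloidCutoff x) with hw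
    have hw0 : 0 ≤ w := sub_nonneg.2 (hmin y)
    have h1 : u y / (1 + ‖y‖) ^ N ≤
        w / (1 + ‖y‖) ^ N + A * (paraboloidCutoff y / (1 + ‖y‖) ^ N) := by
      rw [← mul_div_assoc, ← add_div]
      gcongr
      linarith
    have h2 : w / (1 + ‖y‖) ^ N ≤ w / dist x y ^ N := by gcongr
    have h3 : w / dist x y ^ N = A * ((paraboloidCutoff x - paraboloidCutoff y) / dist x y ^ N)
        - (u x - u y) / dist x y ^ N := by
      rw [hw]; ring
    have h4 := mul_le_mul_of_nonneg_left hker hA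
    have h5 := mul_le_mul_of_nonneg_left hcut hA
    linarith
  have hTG : Integrable (fun y => truncatedLinear n N ε p (y - x) + kernelMajorant n N (y - x)) :=
    hT.add hG
  have hsum : Integrable (fun y => truncatedLinear n N ε p (y - x) + kernelMajorant n N (y - x)
      + (ball (0 : Euc n) 1).indicator (fun _ => (2 : ℝ)) y) := hTG.add hB
  refine (setIntegral_mono_on (hL.integrable_div hs0).integrableOn
    ((hsum.const_mul A).integrableOn.sub hF) hSm hpt).trans ?_
  simp only [Pi.sub_apply]
  rw [integral_sub (hsum.const_mul A).integrableOn hF, integral_const_mul]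
  gcongr
  have hTz : ∫ y in S, truncatedLinear n N ε p (y - x) = 0 := by
    rw [setIntegral_eq_integral_of_forall_compl_eq_zero,
      integral_sub_right_eq_self (truncatedLinear n N ε p), integral_truncatedLinear]
    intro y hy
    refine indicator_of_notMem (fun h => hy ?_) _
    change ε ≤ dist x y
    rw [dist_comm, dist_eq_norm]
    exact h.1
  have hGz : ∫ y in S, kernelMajorant n N (y - x) ≤ ∫ z, kernelMajorant n N z := by
    rw [← integral_sub_right_eq_self (kernelMajorant n N) x]
    exact setIntegral_le_integral hG (ae_of_all _ fun y => kernelMajorant_nonneg _)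
  have hBz : ∫ y in S, (ball (0 : Euc n) 1).indicator (fun _ => (2 : ℝ)) y ≤
      2 * volume.real (ball (0 : Euc n) 1) := by
    refine (setIntegral_le_integral hB (ae_of_all _ fun y =>
      indicator_nonneg (fun _ _ => zero_le_two) y)).trans_eq ?_
    rw [integral_indicator measurableSet_ball, setIntegral_const, smul_eq_mul, mul_comm]
  have hsplit : ∫ y in S, (truncatedLinear n N ε p (y - x) + kernelMajorant n N (y - x)
      + (ball (0 : Euc n) 1).indicator (fun _ => (2 : ℝ)) y) =
      (∫ y in S, truncatedLinear n N ε p (y - x)) + (∫ y in S, kernelMajorant n N (y - x))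
      + ∫ y in S, (ball (0 : Euc n) 1).indicator (fun _ => (2 : ℝ)) y := by
    rw [integral_add hTG.integrableOn hB.integrableOn,
      integral_add hT.integrableOn hG.integrableOn]
  refine hsplit.trans_le ?_
  linarith

lemma aecover_le_dist {n : ℕ} (hn : 1 ≤ n) (x : Euc n) :
    AECover volume (𝓝[>] (0 : ℝ)) (fun ε : ℝ => {y : Euc n | ε ≤ dist x y}) := by
  have : Nonempty (Fin n) := ⟨⟨0, hn⟩⟩
  refine ⟨?_, measurableSet_le_dist x⟩
  filter_upwards [Measure.ae_ne volume x] with y hy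
  filter_upwards [Ioc_mem_nhdsGT (dist_pos.2 hy.symm)] with ε hε using hε.2

lemma integral_div_le {n : ℕ} (hn : 1 ≤ n) {s : ℝ} (hs0 : 0 < s) (hs1 : s < 1) {C₀ : ℝ}
    {u : Euc n → ℝ} (hu : ∀ x, 0 ≤ u x) (hc : ContinuousOn u (ball 0 1)) (hL : MemL2s n s u)
    (hv : ∀ x ∈ ball (0 : Euc n) 1, ∃ v : ℝ, HasFracLapAt n s u x v ∧ -C₀ ≤ v)
    {x₀ : Euc n} (hx₀ : ‖x₀‖ ≤ 1 / 2) :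
    ∫ y, u y / (1 + ‖y‖) ^ ((n : ℝ) + 2 * s) ≤
      u x₀ * ((∫ z, kernelMajorant n (n + 2 * s) z) + 2 * volume.real (ball (0 : Euc n) 1))
        + C₀ / fracC n s := by
  obtain ⟨x, hx, h0, hmin⟩ := exists_touching_point hu hc hx₀
  obtain ⟨v, hlap, hv⟩ := hv x (by simpa using hx)
  have hC := fracC_pos n hs0 hs1
  have hlim : Tendsto (fun ε : ℝ =>
      ∫ y in {y : Euc n | ε ≤ dist x y}, (u x - u y) / dist x y ^ ((n : ℝ) + 2 * s))
      (𝓝[>] (0 : ℝ)) (𝓝 (v / fracC n s)) := by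
    refine (Tendsto.div_const hlap (fracC n s)).congr fun ε => ?_
    rw [mul_div_cancel_left₀ _ hC.ne']
  have hle := le_of_tendsto_of_tendsto
    ((aecover_le_dist hn x).integral_tendsto_of_countably_generated (hL.integrable_div hs0))
    (hlim.const_sub _)
    (eventually_nhdsWithin_of_forall fun ε hε =>
      setIntegral_div_le hn hs0 hs1 hL (hu x₀) hx h0 hmin hε)
  have hdiv : -C₀ / fracC n s ≤ v / fracC n s := by gcongr
  rw [neg_div] at hdiv
  linarith

/-- weak Harnack inequality: there is `C = C(n,s) > 0` such that for every
`C₀ > 0` and every nonnegative `u ∈ C^{1,1}_{loc}(B₁(0)) ∩ L_{2s}` with `(-Δ)^s u ≥ -C₀`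
classically in `B₁(0)`, one has `∫_{ℝⁿ} u(y)/(1+|y|)^{n+2s} dy ≤ C (inf_{B_{1/2}} u + C₀)`. -/
theorem weak_harnack (n : ℕ) (hn : 1 ≤ n) (s : ℝ) (hs0 : 0 < s) (hs1 : s < 1) :
    ∃ C : ℝ, 0 < C ∧
      ∀ (C₀ : ℝ), 0 < C₀ →
        ∀ u : Euc n → ℝ, (∀ x, 0 ≤ u x) →
          C11LocOn n u (ball (0 : Euc n) 1) → MemL2s n s u →
          (∀ x ∈ ball (0 : Euc n) 1, ∃ v : ℝ, HasFracLapAt n s u x v ∧ -C₀ ≤ v) →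
          ∫⁻ y : Euc n, ENNReal.ofReal (u y / (1 + ‖y‖) ^ ((n : ℝ) + 2 * s)) ≤
            ENNReal.ofReal (C * (sInf (u '' ball (0 : Euc n) (1/2)) + C₀)) := by
  have hC := fracC_pos n hs0 hs1
  set K : ℝ := (∫ z, kernelMajorant n (n + 2 * s) z) + 2 * volume.real (ball (0 : Euc n) 1)
    with hK
  have hK0 : 0 ≤ K :=
    add_nonneg (integral_nonneg fun z => kernelMajorant_nonneg z) (by positivity)
  have hCK : 0 < K + 1 / fracC n s := by positivity
  refine ⟨K + 1 / fracC n s, hCK, fun C₀ hC₀ u hu h11 hL hv => ?_⟩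
  rw [← ofReal_integral_eq_lintegral_ofReal (hL.integrable_div hs0)
    (ae_of_all _ fun y => div_nonneg (hu y) (by positivity))]
  refine ENNReal.ofReal_le_ofReal ?_
  rw [← div_le_iff₀' hCK, ← sub_le_iff_le_add]
  refine le_csInf ((nonempty_ball.2 (by norm_num)).image u) ?_
  rintro _ ⟨x₀, hx₀, rfl⟩
  rw [sub_le_iff_le_add, div_le_iff₀' hCK]
  have hx₀ : ‖x₀‖ < 1 / 2 := by simpa using hx₀
  refine (integral_div_le hn hs0 hs1 hu h11.continuousOn hL hv hx₀.le).trans ?_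
  have h1 : 0 ≤ u x₀ * (1 / fracC n s) := mul_nonneg (hu x₀) (by positivity)
  have h2 : 0 ≤ K * C₀ := by positivity
  rw [← hK, div_eq_mul_one_div C₀]
  linarith
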